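/- Let Φ be a positive trace-preserving real-linear map on Hermitian 2×2 matrices and w ∈ ℝ such that the real symmetric 4×4 matrix Q_w of the quadratic form q_w(x) = Φ(x)·Φ(x) − w x·x is positive semidefinite. Then for every qubit state ρ with vector x, √(q_w(x)) ≤ C_Φ(ρ), i.e., √q_w is a lower bound for the concurrence. -/

import Mathlib

open scoped Matrix ComplexOrder
open Matrix

noncomputable section

/-- Pauli matrix σ₁ -/
def pauli1 : Matrix (Fin 2) (Fin 2) ℂ := !![0, 1; 1, 0]
/-- Pauli matrix σ₂ -/
def pauli2 : Matrix (Fin 2) (Fin 2) ℂ := !![0, -Complex.I; Complex.I, 0]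
/-- Pauli matrix σ₃ -/
def pauli3 : Matrix (Fin 2) (Fin 2) ℂ := !![1, 0; 0, -1]

/-- The map x ↦ ½(x₀ I + x₁σ₁ + x₂σ₂ + x₃σ₃). -/
def toMat (x : Fin 4 → ℝ) : Matrix (Fin 2) (Fin 2) ℂ :=
  (1 / 2 : ℂ) • ((x 0 : ℂ) • (1 : Matrix (Fin 2) (Fin 2) ℂ) +
    (x 1 : ℂ) • pauli1 + (x 2 : ℂ) • pauli2 + (x 3 : ℂ) • pauli3)

/-- Minkowski inner product on ℝ⁴. -/
def mink (x y : Fin 4 → ℝ) : ℝ := x 0 * y 0 - x 1 * y 1 - x 2 * y 2 - x 3 * y 3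

/-- Bloch-picture action of a trace-preserving linear map:
(x₀, x⃗) ↦ (x₀, x₀ t⃗ + Λ x⃗). -/
def phiVec (t : Fin 3 → ℝ) (Λ : Matrix (Fin 3) (Fin 3) ℝ) (x : Fin 4 → ℝ) : Fin 4 → ℝ :=
  ![x 0,
    x 0 * t 0 + ∑ j : Fin 3, Λ 0 j * x j.succ,
    x 0 * t 1 + ∑ j : Fin 3, Λ 1 j * x j.succ,
    x 0 * t 2 + ∑ j : Fin 3, Λ 2 j * x j.succ]

/-- The quadratic form q_w(x) = Φ(x)·Φ(x) − w x·x. -/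
def qform (t : Fin 3 → ℝ) (Λ : Matrix (Fin 3) (Fin 3) ℝ) (w : ℝ) (x : Fin 4 → ℝ) : ℝ :=
  mink (phiVec t Λ x) (phiVec t Λ x) - w * mink x x

/-- Positivity of the map in the Bloch picture: positive semidefinite matrices are
mapped to positive semidefinite matrices. -/
def IsPosMap (t : Fin 3 → ℝ) (Λ : Matrix (Fin 3) (Fin 3) ℝ) : Prop :=
  ∀ x : Fin 4 → ℝ, (toMat x).PosSemidef → (toMat (phiVec t Λ x)).PosSemidef

/-- x is the Bloch vector of a qubit state. -/
def IsStateVec (x : Fin 4 → ℝ) : Prop := (toMat x).PosSemidef ∧ x 0 = 1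

/-- x is the Bloch vector of a pure qubit state (determinant zero, i.e. x·x = 0). -/
def IsPureVec (x : Fin 4 → ℝ) : Prop := (toMat x).PosSemidef ∧ x 0 = 1 ∧ mink x x = 0

/-- Concurrence of a pure state: C_Φ(π) = 2√(det Φ(π)). -/
def pureConc (t : Fin 3 → ℝ) (Λ : Matrix (Fin 3) (Fin 3) ℝ) (y : Fin 4 → ℝ) : ℝ :=
  2 * Real.sqrt ((toMat (phiVec t Λ y)).det.re)

/-- Concurrence of a (mixed) state with Bloch vector x: the infimum over finite
convex decompositions into pure states of the average pure-state concurrence. -/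
def conc (t : Fin 3 → ℝ) (Λ : Matrix (Fin 3) (Fin 3) ℝ) (x : Fin 4 → ℝ) : ℝ :=
  sInf {c : ℝ | ∃ (k : ℕ) (p : Fin k → ℝ) (y : Fin k → (Fin 4 → ℝ)),
    (∀ j, 0 < p j) ∧ (∑ j, p j) = 1 ∧ (∀ j, IsPureVec (y j)) ∧
    (∀ i, (∑ j, p j * y j i) = x i) ∧ c = ∑ j, p j * pureConc t Λ (y j)}

end

theorem det_toMat (x : Fin 4 → ℝ) : (toMat x).det = ((mink x x / 4 : ℝ) : ℂ) := by
  have hI : Complex.I ^ 2 = -1 := Complex.I_sq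
  simp only [toMat, pauli1, pauli2, pauli3, mink, Matrix.det_fin_two, Matrix.smul_apply,
    Matrix.add_apply, Matrix.one_apply, Matrix.of_apply, Matrix.cons_val', Matrix.cons_val_zero,
    Matrix.cons_val_one, smul_eq_mul]
  push_cast
  norm_num
  linear_combination (x 2 : ℂ) ^ 2 / 4 * hI

theorem isHermitian_toMat (x : Fin 4 → ℝ) : (toMat x).IsHermitian := by
  ext i j
  fin_cases i <;> fin_cases j <;> simp [toMat, pauli1, pauli2, pauli3] <;> ring

theorem toMat_mul_self {x : Fin 4 → ℝ} (h0 : x 0 = 1) (hx : mink x x = 0) :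
    toMat x * toMat x = toMat x := by
  have htr : (toMat x).trace = 1 := by
    simp [toMat, pauli1, pauli2, pauli3, Matrix.trace_fin_two, h0]
  have hdet : (toMat x).det = 0 := by simp [det_toMat, hx]
  rw [Matrix.trace_fin_two] at htr
  rw [Matrix.det_fin_two] at hdet
  ext i j
  fin_cases i <;> fin_cases j <;> simp [Matrix.mul_apply, Fin.sum_univ_two]
  · linear_combination toMat x 0 0 * htr - hdet
  · linear_combination toMat x 0 1 * htr
  · linear_combination toMat x 1 0 * htr
  · linear_combination toMat x 1 1 * htr - hdet

theorem isPureVec_of_mink_eq_zero {x : Fin 4 → ℝ} (h0 : x 0 = 1) (hx : mink x x = 0) :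
    IsPureVec x := by
  refine ⟨?_, h0, hx⟩
  have h := Matrix.posSemidef_conjTranspose_mul_self (toMat x)
  rwa [(isHermitian_toMat x).eq, toMat_mul_self h0 hx] at h

theorem IsStateVec.mink_nonneg {x : Fin 4 → ℝ} (hx : IsStateVec x) : 0 ≤ mink x x := by
  have h := hx.1.det_nonneg
  rw [det_toMat, Complex.zero_le_real] at h
  linarith

theorem pureConc_eq_sqrt_qform (t : Fin 3 → ℝ) (Λ : Matrix (Fin 3) (Fin 3) ℝ) (w : ℝ)
    {y : Fin 4 → ℝ} (hy : IsPureVec y) : pureConc t Λ y = √(qform t Λ w y) := by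
  rw [pureConc, qform, det_toMat, Complex.ofReal_re, hy.2.2, mul_zero, sub_zero,
    Real.sqrt_div' _ (by norm_num), show (4 : ℝ) = 2 ^ 2 by norm_num,
    Real.sqrt_sq (by norm_num)]
  ring

/-- Every qubit state is a finite convex combination of pure states. -/
theorem IsStateVec.exists_pure_decomposition {x : Fin 4 → ℝ} (hx : IsStateVec x) :
    ∃ (k : ℕ) (p : Fin k → ℝ) (y : Fin k → (Fin 4 → ℝ)),
      (∀ j, 0 < p j) ∧ (∑ j, p j) = 1 ∧ (∀ j, IsPureVec (y j)) ∧
      (∀ i, (∑ j, p j * y j i) = x i) := by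
  have h0 := hx.2
  rcases hx.mink_nonneg.eq_or_lt with h | h
  · exact ⟨1, fun _ => 1, fun _ => x, by simp, by simp,
      fun _ => isPureVec_of_mink_eq_zero h0 h.symm, by simp⟩
  · have h' : x 1 ^ 2 < 1 - x 2 ^ 2 - x 3 ^ 2 := by
      simp only [mink, h0] at h
      linarith
    set s := √(1 - x 2 ^ 2 - x 3 ^ 2)
    have hpos : 0 < 1 - x 2 ^ 2 - x 3 ^ 2 := (sq_nonneg _).trans_lt h'
    have hs : 0 < s := Real.sqrt_pos.2 hpos
    have hs2 : s ^ 2 = 1 - x 2 ^ 2 - x 3 ^ 2 := Real.sq_sqrt hpos.le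
    obtain ⟨hl, hr⟩ := abs_lt_of_sq_lt_sq' (h'.trans_eq hs2.symm) hs.le
    refine ⟨2, ![(s + x 1) / (2 * s), (s - x 1) / (2 * s)],
      ![![1, s, x 2, x 3], ![1, -s, x 2, x 3]], ?_, ?_, ?_, ?_⟩
    · intro j
      fin_cases j
      · exact div_pos (by linarith) (by linarith)
      · exact div_pos (by linarith) (by linarith)
    · simp only [Fin.sum_univ_two, Matrix.cons_val_zero, Matrix.cons_val_one]
      field_simp
      ring
    · intro j
      fin_cases j <;> refine isPureVec_of_mink_eq_zero rfl ?_ <;> simp [mink] <;>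
        linear_combination -hs2
    · intro i
      fin_cases i <;> simp [Fin.sum_univ_two, h0] <;> field_simp <;> ring

open scoped MatrixOrder Matrix.Norms.L2Operator in
/-- The square root of a positive semidefinite quadratic form is a seminorm. -/
theorem Matrix.PosSemidef.exists_seminorm_eq_sqrt {n : Type*} [Fintype n]
    {Q : Matrix n n ℝ} (hQ : Q.PosSemidef) :
    ∃ f : Seminorm ℝ (n → ℝ), ∀ y, f y = √(y ⬝ᵥ Q *ᵥ y) := by
  classical
  obtain ⟨B, rfl⟩ := CStarAlgebra.nonneg_iff_eq_star_mul_self.1 hQ.nonneg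
  refine ⟨(normSeminorm ℝ (EuclideanSpace ℝ n)).comp
    ((WithLp.linearEquiv 2 ℝ (n → ℝ)).symm.toLinearMap ∘ₗ B.mulVecLin), fun y => ?_⟩
  rw [Matrix.star_eq_conjTranspose]
  have hB : y ⬝ᵥ (Bᴴ * B) *ᵥ y = (B *ᵥ y) ⬝ᵥ (B *ᵥ y) := by
    rw [← Matrix.mulVec_mulVec, Matrix.dotProduct_mulVec, Matrix.conjTranspose_eq_transpose_of_trivial,
      Matrix.vecMul_transpose]
  rw [hB]
  simp [EuclideanSpace.norm_eq, dotProduct, sq]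

/-- if Φ is a positive trace-preserving map and w is such that the
symmetric matrix Q_w of the form q_w(x) = Φ(x)·Φ(x) − w x·x is positive semidefinite,
then √q_w is a lower bound for the concurrence on qubit states. -/
theorem stmt5 (t : Fin 3 → ℝ) (Λ : Matrix (Fin 3) (Fin 3) ℝ) (hpos : IsPosMap t Λ)
    (w : ℝ) (Q : Matrix (Fin 4) (Fin 4) ℝ) (hsymm : Q.IsSymm)
    (hrepr : ∀ y : Fin 4 → ℝ, y ⬝ᵥ Q.mulVec y = qform t Λ w y)
    (hpsd : Q.PosSemidef)
    (x : Fin 4 → ℝ) (hx : IsStateVec x) :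
    Real.sqrt (qform t Λ w x) ≤ conc t Λ x := by
  have hne : {c : ℝ | ∃ (k : ℕ) (p : Fin k → ℝ) (y : Fin k → (Fin 4 → ℝ)),
      (∀ j, 0 < p j) ∧ (∑ j, p j) = 1 ∧ (∀ j, IsPureVec (y j)) ∧
      (∀ i, (∑ j, p j * y j i) = x i) ∧ c = ∑ j, p j * pureConc t Λ (y j)}.Nonempty := by
    obtain ⟨k, p, y, hp, hsum, hy, hxy⟩ := hx.exists_pure_decomposition
    exact ⟨_, k, p, y, hp, hsum, hy, hxy, rfl⟩
  obtain ⟨f, hf⟩ := hpsd.exists_seminorm_eq_sqrt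
  simp only [hrepr] at hf
  refine le_csInf hne ?_
  rintro c ⟨k, p, y, hp, -, hy, hxy, rfl⟩
  have hx' : x = ∑ j, p j • y j := by
    ext i
    simp [hxy]
  rw [← hf, hx']
  refine (Finset.le_sum_of_subadditive f (map_zero f).le (map_add_le_add f) _ _).trans_eq (Finset.sum_congr rfl fun j _ => ?_)
  rw [map_smul_eq_mul, Real.norm_of_nonneg (hp j).le, hf, pureConc_eq_sqrt_qform t Λ w (hy j)]
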